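/- Let n ≥ 1 and m ≥ 1 be integers, let s₁, …, s_m : Fin n → ℕ be pairwise distinct exponent vectors, each not identically zero, and let ε > 0. Then for Lebesgue-almost every x ∈ ℝⁿ there exists a constant κ > 0 such that for every integer p and every q = (q₁, …, q_m) ∈ ℤ^m with q ≠ 0, |p + q₁·ψ₁(x) + ⋯ + q_m·ψ_m(x)| > κ / (max_i |q_i|)^{m+ε}, where ψ_i(x) = ∏_{j=1}^{n} x_j^{s_i(j)}. -/

import Mathlib

open MeasureTheory

/-- Dyadic half-open interval of level `n` and index `a`. -/
def Dy (n : ℕ) (a : ℤ) : Set ℝ := {t | ⌊t * 2 ^ n⌋ = a}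

lemma Dy_eq (n : ℕ) (a : ℤ) : Dy n a = Set.Ico ((a : ℝ) / 2 ^ n) (((a : ℝ) + 1) / 2 ^ n) := by
  ext t
  have h : (0 : ℝ) < 2 ^ n := by positivity
  simp only [Dy, Set.mem_ofPred_eq, Set.mem_Ico, Int.floor_eq_iff, div_le_iff₀ h, lt_div_iff₀ h]

lemma vol_Dy (n : ℕ) (a : ℤ) : volume (Dy n a) = ENNReal.ofReal (1 / 2 ^ n) := by
  rw [Dy_eq, Real.volume_Ico]; congr 1; ring

lemma meas_Dy (n : ℕ) (a : ℤ) : MeasurableSet (Dy n a) := by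
  rw [Dy_eq]; exact measurableSet_Ico

lemma Dy_lt (n : ℕ) (a : ℤ) : (a : ℝ) / 2 ^ n < ((a : ℝ) + 1) / 2 ^ n := by
  gcongr; linarith

lemma floor_dy (t : ℝ) (n k : ℕ) : ⌊t * 2 ^ n⌋ = ⌊t * 2 ^ (n + k)⌋ / 2 ^ k := by
  have : t * 2 ^ n = (t * 2 ^ (n + k)) / ((2 ^ k : ℕ) : ℝ) := by
    push_cast; rw [pow_add]; field_simp
  rw [this, Int.floor_div_natCast]; norm_cast

lemma Dy_sub {t : ℝ} {n k : ℕ} (h : n ≤ k) : Dy k ⌊t * 2 ^ k⌋ ⊆ Dy n ⌊t * 2 ^ n⌋ := by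
  obtain ⟨j, rfl⟩ := Nat.exists_eq_add_of_le h
  intro u hu
  simp only [Dy, Set.mem_ofPred_eq] at hu ⊢
  rw [floor_dy u n j, hu, ← floor_dy]

lemma mem_Dy_self (t : ℝ) (n : ℕ) : t ∈ Dy n ⌊t * 2 ^ n⌋ := rfl

lemma exists_Dy_sub {U : Set ℝ} (hU : IsOpen U) {t : ℝ} (ht : t ∈ U) (n₀ : ℕ) :
    ∃ n, n₀ ≤ n ∧ Dy n ⌊t * 2 ^ n⌋ ⊆ U := by
  obtain ⟨r, hr, hrU⟩ := Metric.isOpen_iff.1 hU t ht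
  obtain ⟨n, hn⟩ := exists_pow_lt_of_lt_one hr (by norm_num : (1 / 2 : ℝ) < 1)
  refine ⟨max n₀ n, le_max_left _ _, fun u hu => hrU ?_⟩
  have h1 : (1 / 2 : ℝ) ^ (max n₀ n) ≤ (1 / 2) ^ n :=
    pow_le_pow_of_le_one (by norm_num) (by norm_num) (le_max_right _ _)
  set N := max n₀ n
  have h2 := mem_Dy_self t N
  rw [Dy_eq] at hu h2
  have h3 : ((⌊t * 2 ^ N⌋ : ℝ) + 1) / 2 ^ N = (⌊t * 2 ^ N⌋ : ℝ) / 2 ^ N + (1 / 2) ^ N := by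
    rw [add_div, one_div_pow]
  rw [h3] at hu h2
  rw [Metric.mem_ball, Real.dist_eq, abs_lt]
  constructor <;> linarith [hu.1, hu.2, h2.1, h2.2]

/-- Protected points of Kleinbock and Margulis. -/
def Prot {P : Type*} [PartialOrder P] (ψ : P → ℝ → ℝ) (ε ρ : ℝ) (T : Set P) (z : ℝ) : Prop :=
  ∃ S : Finset P, (S : Set P) ⊆ T ∧ IsChain (· ≤ ·) (S : Set P) ∧
    (∀ s ∈ S, ε ≤ ψ s z ∧ ψ s z < ρ) ∧
    ∀ s ∈ T, s ∉ S → (∀ u ∈ S, s ≤ u ∨ u ≤ s) → ρ ≤ ψ s z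

/-- Constants in the nondivergence estimate. -/
noncomputable def KK : ℕ → ENNReal
  | 0 => 0
  | k + 1 => 2 * (1 + KK k)

lemma KK_ne_top (k : ℕ) : KK k ≠ ⊤ := by
  induction k with
  | zero => simp [KK]
  | succ k ih => simp only [KK]; exact ENNReal.mul_ne_top (by simp) (by simp [ih])

theorem nondiv {P : Type*} [PartialOrder P] (ψ : P → ℝ → ℝ) (hcont : ∀ s, Continuous (ψ s))
    (ε ρ : ℝ) (g : ENNReal)
    (hg : ∀ s n a, (∃ t ∈ Dy n a, ρ ≤ ψ s t) →
      volume (Dy n a ∩ {t | ψ s t < ε}) ≤ g * volume (Dy n a)) :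
    ∀ (k : ℕ) (T : Set P),
      (∀ S : Finset P, (S : Set P) ⊆ T → IsChain (· ≤ ·) (S : Set P) → S.card ≤ k) →
      ∀ n a, (∀ s ∈ T, ∃ t ∈ Dy n a, ρ ≤ ψ s t) →
        volume (Dy n a ∩ {z | ¬ Prot ψ ε ρ T z}) ≤ KK k * g * volume (Dy n a) := by
  classical
  intro k
  induction k with
  | zero =>
    intro T hT n a _
    have hemp : ∀ s, s ∉ T := by
      intro s hs
      have := hT {s} (by simpa using hs) (by simp)
      simp at this
    have : {z | ¬ Prot ψ ε ρ T z} = ∅ := by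
      ext z
      simp only [Set.mem_ofPred_eq, Set.mem_empty_iff_false, iff_false, not_not]
      exact ⟨∅, by simp, by simp, by simp, fun s hs => absurd hs (hemp s)⟩
    rw [this]; simp
  | succ k ih =>
    intro T hT n₀ a₀ hsup
    let Q : ℕ → ℤ → Prop := fun n a => ∃ s ∈ T, ∀ t ∈ Dy n a, ψ s t < ρ
    let Sel : Set (ℕ × ℤ) := {x | Q (x.1 + 1) x.2 ∧ ∃ t, t ∈ Dy (x.1 + 1) x.2 ∧ t ∈ Dy n₀ a₀ ∧
      n₀ ≤ x.1 ∧ ¬ Q x.1 ⌊t * 2 ^ x.1⌋}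
    -- estimate on one selected interval
    have hone : ∀ x ∈ Sel, volume (Dy (x.1 + 1) x.2 ∩ {z | ¬ Prot ψ ε ρ T z}) ≤
        KK (k + 1) * g * volume (Dy (x.1 + 1) x.2) := by
      rintro ⟨n, a⟩ ⟨⟨s, hsT, hs⟩, t, ht, -, -, hnQ⟩
      simp only at hs ht hnQ ⊢
      have hnQ' : ∀ u ∈ T, ∃ t' ∈ Dy n ⌊t * 2 ^ n⌋, ρ ≤ ψ u t' := by
        intro u hu
        by_contra hcon
        push Not at hcon
        exact hnQ ⟨u, hu, hcon⟩
      have hsub : Dy (n + 1) a ⊆ Dy n ⌊t * 2 ^ n⌋ := by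
        have := Dy_sub (t := t) (Nat.le_succ n)
        rwa [show ⌊t * 2 ^ (n + 1)⌋ = a from ht] at this
      let Ts : Set P := {u | u ∈ T ∧ u ≠ s ∧ (u ≤ s ∨ s ≤ u)}
      have hins : ∀ S : Finset P, (S : Set P) ⊆ Ts → IsChain (· ≤ ·) (S : Set P) →
          IsChain (· ≤ ·) ((insert s S : Finset P) : Set P) := by
        intro S hS hc
        rw [Finset.coe_insert]
        exact hc.insert (fun b hb _ => (hS hb).2.2.symm)
      have h1 := ih Ts (by
        intro S hS hc
        have hsS : s ∉ S := fun h => (hS h).2.1 rfl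
        have := hT (insert s S) (by
          rw [Finset.coe_insert]
          exact Set.insert_subset hsT (fun u hu => (hS hu).1)) (hins S hS hc)
        rw [Finset.card_insert_of_notMem hsS] at this
        omega) n ⌊t * 2 ^ n⌋ (fun u hu => hnQ' u hu.1)
      have h2 := hg s n ⌊t * 2 ^ n⌋ (hnQ' s hsT)
      have hcov : Dy (n + 1) a ∩ {z | ¬ Prot ψ ε ρ T z} ⊆
          (Dy n ⌊t * 2 ^ n⌋ ∩ {t | ψ s t < ε}) ∪
          (Dy n ⌊t * 2 ^ n⌋ ∩ {z | ¬ Prot ψ ε ρ Ts z}) := by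
        rintro z ⟨hz, hzP⟩
        by_cases hze : ψ s z < ε
        · exact Or.inl ⟨hsub hz, hze⟩
        · refine Or.inr ⟨hsub hz, fun hP => hzP ?_⟩
          obtain ⟨S, hS, hc, hm1, hm2⟩ := hP
          refine ⟨insert s S, ?_, hins S hS hc, ?_, ?_⟩
          · rw [Finset.coe_insert]
            exact Set.insert_subset hsT (fun u hu => (hS hu).1)
          · intro u hu
            rcases Finset.mem_insert.1 hu with rfl | hu
            · exact ⟨not_lt.1 hze, hs z hz⟩
            · exact hm1 u hu
          · intro u huT huS hcomp
            have hus : u ≠ s := fun h => huS (h ▸ Finset.mem_insert_self _ _)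
            exact hm2 u ⟨huT, hus, hcomp s (Finset.mem_insert_self _ _)⟩
              (fun h => huS (Finset.mem_insert_of_mem h))
              (fun w hw => hcomp w (Finset.mem_insert_of_mem hw))
      have hvol : volume (Dy n ⌊t * 2 ^ n⌋) = 2 * volume (Dy (n + 1) a) := by
        rw [vol_Dy, vol_Dy, show (2 : ENNReal) = ENNReal.ofReal 2 by simp,
          ← ENNReal.ofReal_mul (by norm_num)]
        congr 1; rw [pow_succ]; field_simp
      calc _ ≤ _ := measure_mono hcov
        _ ≤ _ := measure_union_le _ _
        _ ≤ g * volume (Dy n ⌊t * 2 ^ n⌋) + KK k * g * volume (Dy n ⌊t * 2 ^ n⌋) := add_le_add h2 h1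
        _ = _ := by rw [hvol]; simp only [KK]; ring
    have hcover : Dy n₀ a₀ ∩ {z | ¬ Prot ψ ε ρ T z} ⊆
        ⋃ x ∈ Sel, (Dy (x.1 + 1) x.2 ∩ {z | ¬ Prot ψ ε ρ T z}) := by
      rintro z ⟨hz, hzP⟩
      have : ∃ s ∈ T, ψ s z < ρ := by
        by_contra hcon
        push Not at hcon
        exact hzP ⟨∅, by simp, by simp, by simp, fun s hs _ _ => hcon s hs⟩
      obtain ⟨s, hsT, hsz⟩ := this
      obtain ⟨N, hN, hNs⟩ := exists_Dy_sub ((hcont s).isOpen_preimage _ isOpen_Iio)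
        (show z ∈ ψ s ⁻¹' Set.Iio ρ from hsz) n₀
      have hex : ∃ N, n₀ ≤ N ∧ Q N ⌊z * 2 ^ N⌋ := ⟨N, hN, s, hsT, fun t ht => hNs ht⟩
      have hf := Nat.find_spec hex
      have hmin := fun m => Nat.find_min (m := m) hex
      generalize Nat.find hex = M at hf hmin
      have hM : M ≠ n₀ := by
        rintro rfl
        obtain ⟨-, u, hu, hu'⟩ := hf
        obtain ⟨t, ht, ht'⟩ := hsup u hu
        rw [show ⌊z * 2 ^ M⌋ = a₀ from hz] at hu'
        exact absurd (hu' t ht) (not_lt.2 ht')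
      obtain ⟨M', rfl⟩ : ∃ M', M = M' + 1 := ⟨M - 1, by have := hf.1; omega⟩
      have hM' : n₀ ≤ M' := by have := hf.1; omega
      simp only [Set.mem_iUnion]
      refine ⟨(M', ⌊z * 2 ^ (M' + 1)⌋), ⟨hf.2, z, mem_Dy_self _ _, hz, hM', ?_⟩, mem_Dy_self _ _, hzP⟩
      intro h
      exact hmin M' (by omega) ⟨hM', h⟩
    have hkey : ∀ x ∈ Sel, ∀ y ∈ Sel, ∀ z, z ∈ Dy (x.1 + 1) x.2 → z ∈ Dy (y.1 + 1) y.2 →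
        ¬ x.1 < y.1 := by
      rintro ⟨n, a⟩ ⟨⟨s, hsT, hs⟩, -⟩ ⟨n', a'⟩ ⟨-, t, ht, -, -, hnQ⟩ z hz hz' hlt
      simp only at hs ht hnQ hz hz' hlt
      apply hnQ
      refine ⟨s, hsT, fun w hw => hs w ?_⟩
      have e1 : ⌊t * 2 ^ n'⌋ = ⌊z * 2 ^ n'⌋ := by
        rw [floor_dy t n' 1, floor_dy z n' 1, show ⌊t * 2 ^ (n' + 1)⌋ = a' from ht,
          show ⌊z * 2 ^ (n' + 1)⌋ = a' from hz']
      rw [e1] at hw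
      have := Dy_sub (t := z) (show n + 1 ≤ n' by omega) hw
      rwa [show ⌊z * 2 ^ (n + 1)⌋ = a from hz] at this
    have hdisj : Sel.PairwiseDisjoint (fun x => Dy (x.1 + 1) x.2) := by
      intro x hx y hy hxy
      rw [Function.onFun, Set.disjoint_left]
      intro z hzx hzy
      have h1 := hkey x hx y hy z hzx hzy
      have h2 := hkey y hy x hx z hzy hzx
      have h3 : x.1 = y.1 := by omega
      apply hxy
      refine Prod.ext h3 ?_
      simp only [Dy, Set.mem_ofPred_eq] at hzx hzy
      rw [← hzx, ← hzy, h3]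
    have hsubJ : (⋃ x ∈ Sel, Dy (x.1 + 1) x.2) ⊆ Dy n₀ a₀ := by
      intro z hz
      simp only [Set.mem_iUnion] at hz
      obtain ⟨⟨n, a⟩, ⟨-, t, ht, htJ, hn, -⟩, hz⟩ := hz
      simp only at ht htJ hn hz
      have := Dy_sub (t := t) (show n₀ ≤ n + 1 by omega)
      rw [show ⌊t * 2 ^ (n + 1)⌋ = a from ht, show ⌊t * 2 ^ n₀⌋ = a₀ from htJ] at this
      exact this hz
    have hcount : Sel.Countable := Set.to_countable _
    calc _ ≤ volume (⋃ x ∈ Sel, (Dy (x.1 + 1) x.2 ∩ {z | ¬ Prot ψ ε ρ T z})) := measure_mono hcover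
      _ ≤ ∑' x : Sel, volume (Dy (x.1.1 + 1) x.1.2 ∩ {z | ¬ Prot ψ ε ρ T z}) :=
        measure_biUnion_le _ hcount _
      _ ≤ ∑' x : Sel, KK (k + 1) * g * volume (Dy (x.1.1 + 1) x.1.2) :=
        ENNReal.tsum_le_tsum (fun x => hone x.1 x.2)
      _ = KK (k + 1) * g * ∑' x : Sel, volume (Dy (x.1.1 + 1) x.1.2) := ENNReal.tsum_mul_left
      _ = KK (k + 1) * g * volume (⋃ x ∈ Sel, Dy (x.1 + 1) x.2) := by
        rw [measure_biUnion hcount hdisj (fun x _ => meas_Dy _ _)]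
      _ ≤ _ := by gcongr


lemma exists_sep {E : Set ℝ} {δ : ℝ} (hδ : 0 < δ) (k : ℕ)
    (h : ENNReal.ofReal (2 * k * δ) < volume E) : ∀ j ≤ k + 1,
    ∃ S : Finset ℝ, S.card = j ∧ (S : Set ℝ) ⊆ E ∧ ∀ x ∈ S, ∀ y ∈ S, x ≠ y → δ ≤ |x - y| := by
  classical
  intro j
  induction j with
  | zero => intro _; exact ⟨∅, by simp⟩
  | succ j ih =>
    intro hj
    obtain ⟨S, hc, hS, hsep⟩ := ih (by omega)
    have hex : ∃ z ∈ E, ∀ x ∈ S, δ ≤ |z - x| := by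
      by_contra hcon
      push Not at hcon
      have hsub : E ⊆ ⋃ x ∈ S, Metric.ball x δ := by
        intro z hz
        obtain ⟨x, hx, hzx⟩ := hcon z hz
        simp only [Set.mem_iUnion]
        exact ⟨x, hx, by rwa [Metric.mem_ball, Real.dist_eq]⟩
      have : volume E ≤ ENNReal.ofReal (2 * k * δ) := by
        calc volume E ≤ volume (⋃ x ∈ S, Metric.ball x δ) := measure_mono hsub
          _ ≤ ∑ x ∈ S, volume (Metric.ball x δ) := measure_biUnion_finset_le _ _
          _ = (j : ENNReal) * ENNReal.ofReal (2 * δ) := by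
            simp [Real.volume_ball, hc]
          _ = ENNReal.ofReal (j * (2 * δ)) := by
            rw [ENNReal.ofReal_mul (p := (j : ℝ)) (by positivity), ENNReal.ofReal_natCast]
          _ ≤ _ := by
            apply ENNReal.ofReal_le_ofReal
            have : (j : ℝ) ≤ k := by exact_mod_cast (by omega : j ≤ k)
            nlinarith
      exact absurd h (not_lt.2 this)
    obtain ⟨z, hz, hzS⟩ := hex
    have hzn : z ∉ S := fun h => by have := hzS z h; simp at this; linarith
    refine ⟨insert z S, by rw [Finset.card_insert_of_notMem hzn, hc], ?_, ?_⟩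
    · rw [Finset.coe_insert]; exact Set.insert_subset hz hS
    · intro x hx y hy hxy
      rcases Finset.mem_insert.1 hx with hx | hx <;> rcases Finset.mem_insert.1 hy with hy | hy
      · exact absurd (hx.trans hy.symm) hxy
      · rw [hx]; exact hzS y hy
      · rw [hy, abs_sub_comm]; exact hzS x hx
      · exact hsep x hx y hy hxy

lemma poly_good (D : ℕ) (hD : 1 ≤ D) (P : Polynomial ℝ) (hP : P.natDegree ≤ D) {a b ε ρ : ℝ}
    (hab : a < b) (hε : 0 < ε) (hρ : 0 < ρ) (hex : ∃ t ∈ Set.Ico a b, ρ ≤ |P.eval t|) :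
    volume (Set.Ico a b ∩ {t | |P.eval t| < ε}) ≤
      ENNReal.ofReal (2 * D * (((D + 1) * ε / ρ) ^ (1 / (D : ℝ)) * (b - a))) := by
  classical
  by_contra hcon
  push Not at hcon
  have hba : 0 < b - a := by linarith
  have hD0 : (D : ℝ) ≠ 0 := by positivity
  have hδ : 0 < ((D + 1) * ε / ρ) ^ (1 / (D : ℝ)) * (b - a) := by positivity
  obtain ⟨S, hc, hS, hsep⟩ := exists_sep hδ D hcon (D + 1) le_rfl
  set δ := ((D + 1) * ε / ρ) ^ (1 / (D : ℝ)) * (b - a) with hδdef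
  obtain ⟨t, ht, hPt⟩ := hex
  have hdeg : P.degree < (S.card : WithBot ℕ) := by
    rw [hc]
    exact lt_of_le_of_lt Polynomial.degree_le_natDegree (by exact_mod_cast (by omega))
  have hInteg := Lagrange.eq_interpolate (v := id) (s := S) Function.injective_id.injOn hdeg
  have hev : P.eval t = ∑ x ∈ S, P.eval x * ∏ y ∈ S.erase x, ((x - y)⁻¹ * (t - y)) := by
    conv_lhs => rw [hInteg]
    simp [Lagrange.interpolate_apply, Polynomial.eval_finsetSum, Lagrange.basis,
      Polynomial.eval_prod, Lagrange.basisDivisor]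
  have hterm : ∀ x ∈ S, |P.eval x * ∏ y ∈ S.erase x, ((x - y)⁻¹ * (t - y))| <
      ε * ((b - a) / δ) ^ D := by
    intro x hx
    rw [abs_mul, Finset.abs_prod]
    have h1 : ∏ y ∈ S.erase x, |(x - y)⁻¹ * (t - y)| ≤ ∏ y ∈ S.erase x, ((b - a) / δ) := by
      apply Finset.prod_le_prod (fun _ _ => abs_nonneg _)
      intro y hy
      have hy' := Finset.mem_of_mem_erase hy
      have hd := hsep x hx y hy' (Finset.ne_of_mem_erase hy).symm
      have hyI := (hS hy').1
      rw [abs_mul, abs_inv, ← div_eq_inv_mul]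
      apply div_le_div₀ hba.le _ hδ hd
      rw [abs_le]; constructor <;> linarith [hyI.1, hyI.2, ht.1, ht.2]
    rw [Finset.prod_const, Finset.card_erase_of_mem hx, hc, Nat.add_sub_cancel] at h1
    have h2 : |P.eval x| < ε := (hS hx).2
    calc _ ≤ |P.eval x| * ((b - a) / δ) ^ D := by gcongr
      _ < _ := by
        have : 0 < ((b - a) / δ) ^ D := by positivity
        gcongr
  have hlt : |P.eval t| < (D + 1) * (ε * ((b - a) / δ) ^ D) := by
    rw [hev]
    calc _ ≤ ∑ x ∈ S, |P.eval x * ∏ y ∈ S.erase x, ((x - y)⁻¹ * (t - y))| :=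
          Finset.abs_sum_le_sum_abs _ _
      _ < ∑ x ∈ S, ε * ((b - a) / δ) ^ D := Finset.sum_lt_sum_of_nonempty
          (Finset.card_pos.1 (by omega)) hterm
      _ = _ := by rw [Finset.sum_const, hc]; simp
  have hpow : ((b - a) / δ) ^ D = ρ / ((D + 1) * ε) := by
    rw [hδdef, div_mul_cancel_right₀ hba.ne', inv_pow, ← Real.rpow_natCast, ← Real.rpow_mul (by positivity),
      one_div_mul_cancel hD0, Real.rpow_one, inv_div]
  rw [hpow] at hlt
  have : (D + 1) * (ε * (ρ / ((D + 1) * ε))) = ρ := by field_simp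
  linarith

lemma fam_good {ι : Type*} [Fintype ι] (D : ℕ) (hD : 1 ≤ D) (P : ι → Polynomial ℝ)
    (hP : ∀ i, (P i).natDegree ≤ D) {ε ρ : ℝ} (hε : 0 < ε) (hρ : 0 < ρ) (n : ℕ) (a : ℤ)
    (hex : ∃ t ∈ Dy n a, ρ ≤ ‖fun i => (P i).eval t‖) :
    volume (Dy n a ∩ {t | ‖fun i => (P i).eval t‖ < ε}) ≤
      ENNReal.ofReal (2 * D * (((D + 1) * ε / ρ) ^ (1 / (D : ℝ)))) * volume (Dy n a) := by
  obtain ⟨t, ht, h⟩ := hex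
  have : ∃ i, ρ ≤ |(P i).eval t| := by
    by_contra hcon
    push Not at hcon
    exact absurd ((pi_norm_lt_iff hρ).2 hcon) (not_lt.2 h)
  obtain ⟨i, hi⟩ := this
  have h1 : Dy n a ∩ {t | ‖fun i => (P i).eval t‖ < ε} ⊆ Dy n a ∩ {t | |(P i).eval t| < ε} := by
    rintro u ⟨hu, hu'⟩
    exact ⟨hu, lt_of_le_of_lt (norm_le_pi_norm (fun i => (P i).eval u) i) hu'⟩
  refine (measure_mono h1).trans ?_
  rw [Dy_eq] at ht ⊢
  refine (poly_good D hD (P i) (hP i) (Dy_lt n a) hε hρ ⟨t, ht, hi⟩).trans ?_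
  rw [Real.volume_Ico, ← ENNReal.ofReal_mul (by positivity), mul_assoc, mul_assoc, mul_assoc]

/-- A coefficient of a polynomial of bounded degree is controlled by its values on `[1, 2)`. -/
lemma coeff_bound (D : ℕ) : ∃ K : ℝ, 0 < K ∧ ∀ P : Polynomial ℝ, P.natDegree ≤ D → ∀ e,
    ∃ t ∈ Dy 0 1, |P.coeff e| ≤ K * |P.eval t| := by
  classical
  let v : ℕ → ℝ := fun k => 1 + k / (D + 1)
  let S := Finset.range (D + 1)
  have hv : Set.InjOn v S := by
    intro x _ y _ h
    have hD : (0 : ℝ) < D + 1 := by positivity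
    simp only [v, add_right_inj] at h
    field_simp at h
    exact_mod_cast h
  have hvm : ∀ k ∈ S, v k ∈ Dy 0 1 := by
    intro k hk
    rw [Dy_eq]
    have hk' : (k : ℝ) < D + 1 := by exact_mod_cast Finset.mem_range.1 hk
    have h1 : (k : ℝ) / (D + 1) < 1 := by rw [div_lt_one (by positivity)]; exact hk'
    have h2 : 0 ≤ (k : ℝ) / (D + 1) := by positivity
    simp only [v, Set.mem_Ico]
    norm_num
    exact ⟨h2, by linarith⟩
  let K : ℝ := 1 + ∑ k ∈ S, ∑ e ∈ Finset.range (D + 1), |(Lagrange.basis S v k).coeff e|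
  have hK : 1 ≤ K := by
    have : 0 ≤ ∑ k ∈ S, ∑ e ∈ Finset.range (D + 1), |(Lagrange.basis S v k).coeff e| := by positivity
    simp only [K]; linarith
  refine ⟨K, by linarith, fun P hP e => ?_⟩
  have hdeg : P.degree < (S.card : WithBot ℕ) := by
    simp only [S, Finset.card_range]
    exact lt_of_le_of_lt Polynomial.degree_le_natDegree (by exact_mod_cast (by omega))
  obtain ⟨k₀, hk₀, hmax⟩ := Finset.exists_max_image S (fun k => |P.eval (v k)|) ⟨0, by simp [S]⟩
  refine ⟨v k₀, hvm k₀ hk₀, ?_⟩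
  by_cases he : D < e
  · rw [Polynomial.coeff_eq_zero_of_natDegree_lt (by omega)]
    simp; positivity
  have hInteg := Lagrange.eq_interpolate hv hdeg
  have hco : P.coeff e = ∑ k ∈ S, P.eval (v k) * (Lagrange.basis S v k).coeff e := by
    conv_lhs => rw [hInteg]
    simp [Lagrange.interpolate_apply, Polynomial.finsetSum_coeff]
  rw [hco]
  calc _ ≤ ∑ k ∈ S, |P.eval (v k) * (Lagrange.basis S v k).coeff e| := Finset.abs_sum_le_sum_abs _ _
    _ ≤ ∑ k ∈ S, (∑ e ∈ Finset.range (D + 1), |(Lagrange.basis S v k).coeff e|) * |P.eval (v k₀)| := by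
      apply Finset.sum_le_sum
      intro k hk
      rw [abs_mul, mul_comm]
      refine mul_le_mul ?_ (hmax k hk) (abs_nonneg _)
        (Finset.sum_nonneg (fun _ _ => abs_nonneg _))
      exact Finset.single_le_sum (f := fun e => |(Lagrange.basis S v k).coeff e|)
          (fun _ _ => abs_nonneg _) (Finset.mem_range.2 (by omega))
    _ ≤ _ := by
      rw [← Finset.sum_mul]
      gcongr
      simp only [K]; linarith


section Minors
variable {m : ℕ}

lemma exists_minor {j : ℕ} (V : Fin j → Fin (m + 1) → ℚ) (hV : LinearIndependent ℚ V) :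
    ∃ f : Fin j → Fin (m + 1), (Matrix.of fun x y => V y (f x)).det ≠ 0 := by
  have hr : (Matrix.of V).transpose.rank = j := by
    rw [Matrix.rank_transpose]
    simpa using LinearIndependent.rank_matrix (M := Matrix.of V) hV
  rw [Matrix.rank_eq_finrank_span_row] at hr
  obtain ⟨g, hg, -, hli⟩ := Submodule.exists_fun_fin_finrank_span_eq ℚ
    (Set.range (Matrix.of V).transpose.row)
  choose f hf using hg
  let e : Fin j ≃ Fin (Module.finrank ℚ (Submodule.span ℚ (Set.range (Matrix.of V).transpose.row))) :=
    finCongr hr.symm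
  refine ⟨f ∘ e, ?_⟩
  have hli' : LinearIndependent ℚ (Matrix.of fun x y => V y ((f ∘ e) x)).row := by
    have h1 : (Matrix.of fun x y => V y ((f ∘ e) x)).row = g ∘ e := by
      ext x y
      exact congrFun (hf (e x)) y
    rw [h1]
    exact hli.comp e e.injective
  have := Matrix.linearIndependent_rows_iff_isUnit.1 hli'
  rw [Matrix.isUnit_iff_isUnit_det] at this
  exact this.ne_zero

lemma det_change {j : ℕ} {R : Type*} [CommRing R] [Algebra ℚ R]
    (V V' : Fin j → Fin (m + 1) → ℚ) (r : Matrix (Fin j) (Fin j) ℚ)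
    (h : ∀ y, V' y = ∑ z, r z y • V z) (L : Fin j → ((Fin (m + 1) → ℚ) →ₗ[ℚ] R)) :
    (Matrix.of fun x y => L x (V' y)).det =
      algebraMap ℚ R r.det * (Matrix.of fun x y => L x (V y)).det := by
  have : (Matrix.of fun x y => L x (V' y)) =
      (Matrix.of fun x y => L x (V y)) * (algebraMap ℚ R).mapMatrix r := by
    ext x y
    simp only [Matrix.mul_apply, Matrix.of_apply, h y, map_sum, map_smul, RingHom.mapMatrix_apply,
      Matrix.map_apply]
    refine Finset.sum_congr rfl fun z _ => ?_
    rw [Algebra.smul_def, mul_comm]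
  rw [this, Matrix.det_mul, ← RingHom.map_det, mul_comm]

/-- Integral bases of a rational subspace (of a finite-index sublattice). -/
structure IntFam (W : Submodule ℚ (Fin (m + 1) → ℚ)) {j : ℕ} (V : Fin j → Fin (m + 1) → ℚ) : Prop where
  li : LinearIndependent ℚ V
  mem : ∀ y, V y ∈ W
  int : ∀ y l, ∃ z : ℤ, V y l = z
  rank : Module.finrank ℚ W = j

lemma int_minor {j : ℕ} {V : Fin j → Fin (m + 1) → ℚ} (hInteg : ∀ y l, ∃ z : ℤ, V y l = z)
    (f : Fin j → Fin (m + 1)) : ∃ z : ℤ, (Matrix.of fun x y => V y (f x)).det = z := by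
  choose Z hZ using hInteg
  refine ⟨(Matrix.of fun x y => Z y (f x)).det, ?_⟩
  rw [Int.cast_det]
  congr 1
  ext x y
  simp [hZ]

/-- Total size of the minors. -/
noncomputable def sz {j : ℕ} (V : Fin j → Fin (m + 1) → ℚ) : ℚ :=
  ∑ f : Fin j → Fin (m + 1), |(Matrix.of fun x y => V y (f x)).det|

lemma sz_nat {j : ℕ} {V : Fin j → Fin (m + 1) → ℚ} (hInteg : ∀ y l, ∃ z : ℤ, V y l = z) :
    ∃ n : ℕ, sz V = n := by
  choose Z hZ using int_minor hInteg
  refine ⟨∑ f, (Z f).natAbs, ?_⟩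
  simp [sz, hZ, Nat.cast_natAbs]

lemma sz_pos {j : ℕ} {V : Fin j → Fin (m + 1) → ℚ} (hV : LinearIndependent ℚ V) : 0 < sz V := by
  obtain ⟨f, hf⟩ := exists_minor V hV
  exact Finset.sum_pos' (fun _ _ => abs_nonneg _) ⟨f, Finset.mem_univ _, abs_pos.2 hf⟩

lemma exists_intFam (W : Submodule ℚ (Fin (m + 1) → ℚ)) :
    ∃ V : Fin (Module.finrank ℚ W) → Fin (m + 1) → ℚ, IntFam W V := by
  let b := Module.finBasis ℚ W
  obtain ⟨k, hk⟩ := IsLocalization.exist_integer_multiples_of_finite (nonZeroDivisors ℤ)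
    (fun x : Fin (Module.finrank ℚ W) × Fin (m + 1) => ((b x.1 : Fin (m + 1) → ℚ) x.2))
  have hk0 : ((k : ℤ) : ℚ) ≠ 0 := by exact_mod_cast nonZeroDivisors.coe_ne_zero k
  refine ⟨fun y => ((k : ℤ) : ℚ) • (b y : Fin (m + 1) → ℚ), ?_, ?_, ?_, rfl⟩
  · have h1 : LinearIndependent ℚ (fun y => (b y : Fin (m + 1) → ℚ)) :=
      b.linearIndependent.map' W.subtype (by simp)
    exact h1.units_smul (fun _ => Units.mk0 _ hk0)
  · intro y
    exact W.smul_mem _ (b y).2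
  · intro y l
    obtain ⟨z, hz⟩ := hk (y, l)
    refine ⟨z, ?_⟩
    simpa [zsmul_eq_mul] using hz.symm

lemma exists_min_fam (W : Submodule ℚ (Fin (m + 1) → ℚ)) :
    ∃ V : Fin (Module.finrank ℚ W) → Fin (m + 1) → ℚ, IntFam W V ∧
      ∀ V' : Fin (Module.finrank ℚ W) → Fin (m + 1) → ℚ, IntFam W V' → sz V ≤ sz V' := by
  classical
  have hex : ∃ n : ℕ, ∃ V : Fin (Module.finrank ℚ W) → Fin (m + 1) → ℚ, IntFam W V ∧ sz V = n := by
    obtain ⟨V, hV⟩ := exists_intFam W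
    obtain ⟨n, hn⟩ := sz_nat hV.int
    exact ⟨n, V, hV, hn⟩
  obtain ⟨V, hV, hn⟩ := Nat.find_spec hex
  refine ⟨V, hV, fun V' hV' => ?_⟩
  obtain ⟨n', hn'⟩ := sz_nat hV'.int
  rw [hn, hn']
  exact_mod_cast Nat.find_min' hex ⟨V', hV', hn'⟩

/-- A minimal integral family spanning `W`. -/
noncomputable def VW (W : Submodule ℚ (Fin (m + 1) → ℚ)) :
    Fin (Module.finrank ℚ W) → Fin (m + 1) → ℚ := (exists_min_fam W).choose

lemma VW_int (W : Submodule ℚ (Fin (m + 1) → ℚ)) : IntFam W (VW W) := (exists_min_fam W).choose_spec.1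

lemma VW_compare (W : Submodule ℚ (Fin (m + 1) → ℚ))
    (V' : Fin (Module.finrank ℚ W) → Fin (m + 1) → ℚ) (hV' : IntFam W V') :
    ∃ r : ℚ, 1 ≤ |r| ∧ ∀ (R : Type) [CommRing R] [Algebra ℚ R]
      (L : Fin (Module.finrank ℚ W) → ((Fin (m + 1) → ℚ) →ₗ[ℚ] R)),
      (Matrix.of fun x y => L x (V' y)).det =
        algebraMap ℚ R r * (Matrix.of fun x y => L x (VW W y)).det := by
  have hspan : Submodule.span ℚ (Set.range (VW W)) = W := by
    apply Submodule.eq_of_le_of_finrank_eq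
    · rw [Submodule.span_le]; rintro _ ⟨y, rfl⟩; exact (VW_int W).mem y
    · rw [finrank_span_eq_card (VW_int W).li]; simp
  have hco : ∀ y, ∃ c : Fin (Module.finrank ℚ W) → ℚ, ∑ z, c z • VW W z = V' y := by
    intro y
    have := hV'.mem y
    rw [← hspan] at this
    exact (Submodule.mem_span_range_iff_exists_fun ℚ).1 this
  choose c hc using hco
  have hdc := fun (R : Type) [CommRing R] [Algebra ℚ R] =>
    det_change (R := R) (VW W) V' (fun z y => c y z) (fun y => (hc y).symm)
  refine ⟨Matrix.det (fun z y => c y z), ?_, fun R _ _ L => hdc R L⟩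
  set r := Matrix.det (fun z y => c y z)
  have hs : sz V' = |r| * sz (VW W) := by
    rw [sz, sz, Finset.mul_sum]
    refine Finset.sum_congr rfl fun f _ => ?_
    have := hdc ℚ (fun x => LinearMap.proj (f x))
    simp only [LinearMap.proj_apply] at this
    rw [this, abs_mul]; simp [r]
  have h1 := (exists_min_fam W).choose_spec.2 V' hV'
  have h2 := sz_pos (VW_int W).li
  change sz (VW W) ≤ sz V' at h1
  rw [hs] at h1
  by_contra hcon
  push Not at hcon
  nlinarith

end Minors


section Flow
open Polynomial
variable {m : ℕ}

/-- Entries of the matrix of the flow. -/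
noncomputable def BB (c : Fin (m + 1) → ℝ) (d : Fin (m + 1) → ℕ) (A a : ℝ) (i l : Fin (m + 1)) : ℝ[X] :=
  if i = 0 then C (A * c l) * X ^ d l else if l = i then C a else 0

/-- Rows of the flow as linear maps. -/
noncomputable def LL (c : Fin (m + 1) → ℝ) (d : Fin (m + 1) → ℕ) (A a : ℝ) (i : Fin (m + 1)) :
    (Fin (m + 1) → ℚ) →ₗ[ℚ] ℝ[X] :=
  ∑ l, (LinearMap.proj l : (Fin (m + 1) → ℚ) →ₗ[ℚ] ℚ).smulRight (BB c d A a i l)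

lemma rat_smul_poly (r : ℚ) (p : ℝ[X]) : r • p = C (r : ℝ) * p := by
  rw [Algebra.smul_def]; congr 1

lemma LL_apply (c : Fin (m + 1) → ℝ) (d : Fin (m + 1) → ℕ) (A a : ℝ) (i : Fin (m + 1))
    (w : Fin (m + 1) → ℚ) : LL c d A a i w = ∑ l, C (w l : ℝ) * BB c d A a i l := by
  simp [LL, rat_smul_poly]

lemma LL_zero (c : Fin (m + 1) → ℝ) (d : Fin (m + 1) → ℕ) (A a : ℝ) (w : Fin (m + 1) → ℚ) :
    LL c d A a 0 w = C A * ∑ l, C (w l : ℝ) * (C (c l) * X ^ d l) := by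
  rw [LL_apply, Finset.mul_sum]
  refine Finset.sum_congr rfl fun l _ => ?_
  simp only [BB, if_true, C_mul]; ring

lemma LL_ne (c : Fin (m + 1) → ℝ) (d : Fin (m + 1) → ℕ) (A a : ℝ) {i : Fin (m + 1)} (hi : i ≠ 0)
    (w : Fin (m + 1) → ℚ) : LL c d A a i w = C a * C (w i : ℝ) := by
  rw [LL_apply, Finset.sum_eq_single i]
  · simp [BB, hi, mul_comm]
  · intro l _ hl; simp [BB, hi, hl]
  · simp

/-- Minor polynomial. -/
noncomputable def mn (c : Fin (m + 1) → ℝ) (d : Fin (m + 1) → ℕ) (A a : ℝ) {j : ℕ}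
    (V : Fin j → Fin (m + 1) → ℚ) (f : Fin j → Fin (m + 1)) : ℝ[X] :=
  (Matrix.of fun x y => LL c d A a (f x) (V y)).det

/-- Maximum of the minors. -/
noncomputable def nrm (c : Fin (m + 1) → ℝ) (d : Fin (m + 1) → ℕ) (A a : ℝ) {j : ℕ}
    (V : Fin j → Fin (m + 1) → ℚ) (t : ℝ) : ℝ :=
  ‖fun f : Fin j → Fin (m + 1) => (mn c d A a V f).eval t‖

lemma nrm_cont (c : Fin (m + 1) → ℝ) (d : Fin (m + 1) → ℕ) (A a : ℝ) {j : ℕ}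
    (V : Fin j → Fin (m + 1) → ℚ) : Continuous (nrm c d A a V) := by
  unfold nrm
  exact (continuous_pi fun f => (mn c d A a V f).continuous).norm

lemma nrm_compare (c : Fin (m + 1) → ℝ) (d : Fin (m + 1) → ℕ) (A a : ℝ) {j : ℕ}
    (W : Submodule ℚ (Fin (m + 1) → ℚ)) (V' : Fin j → Fin (m + 1) → ℚ) (hV' : IntFam W V') (t : ℝ) :
    nrm c d A a (VW W) t ≤ nrm c d A a V' t := by
  obtain rfl := hV'.rank
  obtain ⟨r, hr, h⟩ := VW_compare W V' hV'
  refine (pi_norm_le_iff_of_nonneg (norm_nonneg _)).2 fun f => ?_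
  refine le_trans ?_ (norm_le_pi_norm (fun f => (mn c d A a V' f).eval t) f)
  have h1 : mn c d A a V' f = C (r : ℝ) * mn c d A a (VW W) f :=
    h ℝ[X] (fun x => LL c d A a (f x))
  simp only [h1, eval_mul, eval_C, Real.norm_eq_abs, abs_mul]
  have : (1 : ℝ) ≤ |(r : ℝ)| := by exact_mod_cast hr
  nlinarith [abs_nonneg (eval t (mn c d A a (VW W) f))]

lemma nrm_cons (c : Fin (m + 1) → ℝ) (d : Fin (m + 1) → ℕ) (A a : ℝ) {j : ℕ}
    (V : Fin j → Fin (m + 1) → ℚ) (v : Fin (m + 1) → ℚ) (t η : ℝ)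
    (hη : ∀ i, |(LL c d A a i v).eval t| ≤ η) :
    nrm c d A a (Fin.cons v V : Fin (j + 1) → Fin (m + 1) → ℚ) t ≤ (j + 1) * (η * nrm c d A a V t) := by
  have hη0 : 0 ≤ η := (abs_nonneg _).trans (hη 0)
  have hn : 0 ≤ nrm c d A a V t := norm_nonneg _
  refine (pi_norm_le_iff_of_nonneg (by positivity)).2 fun f => ?_
  have hexp : mn c d A a (Fin.cons v V : Fin (j + 1) → Fin (m + 1) → ℚ) f =
      ∑ i : Fin (j + 1), (-1) ^ (i : ℕ) * LL c d A a (f i) v *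
        mn c d A a V (fun x => f (i.succAbove x)) := by
    rw [mn, Matrix.det_succ_column _ 0]
    refine Finset.sum_congr rfl fun i _ => ?_
    simp only [Fin.val_zero, add_zero, Matrix.of_apply, Fin.cons_zero, mn]
    congr 2
  rw [hexp, eval_finsetSum, Real.norm_eq_abs]
  calc _ ≤ ∑ i : Fin (j + 1), |eval t ((-1) ^ (i : ℕ) * LL c d A a (f i) v *
        mn c d A a V (fun x => f (i.succAbove x)))| := Finset.abs_sum_le_sum_abs _ _
    _ ≤ ∑ i : Fin (j + 1), η * nrm c d A a V t := by
      refine Finset.sum_le_sum fun i _ => ?_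
      rw [eval_mul, eval_mul, abs_mul, abs_mul]
      have h1 : |eval t ((-1 : ℝ[X]) ^ (i : ℕ))| = 1 := by simp
      rw [h1, one_mul]
      refine mul_le_mul (hη _) ?_ (abs_nonneg _) hη0
      exact norm_le_pi_norm (fun f => (mn c d A a V f).eval t) (fun x => f (i.succAbove x))
    _ = _ := by simp

lemma mn_deg (c : Fin (m + 1) → ℝ) (d : Fin (m + 1) → ℕ) (A a : ℝ) {D : ℕ} (hD : ∀ i, d i ≤ D)
    {j : ℕ} (hj : j ≤ m + 1)
    (V : Fin j → Fin (m + 1) → ℚ) (f : Fin j → Fin (m + 1)) :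
    (mn c d A a V f).natDegree ≤ (m + 1) * D := by
  have hL : ∀ i w, (LL c d A a i w).natDegree ≤ D := by
    intro i w
    rw [LL_apply]
    refine natDegree_sum_le_of_forall_le _ _ fun l _ => ?_
    refine (natDegree_C_mul_le _ _).trans ?_
    unfold BB
    split_ifs
    · exact (natDegree_C_mul_X_pow_le _ _).trans (hD l)
    · simp
    · simp
  rw [mn, Matrix.det_apply]
  refine natDegree_sum_le_of_forall_le _ _ fun σ _ => ?_
  refine (natDegree_smul_le _ _).trans ?_
  refine (natDegree_prod_le _ _).trans ?_
  calc _ ≤ ∑ _x : Fin j, D := Finset.sum_le_sum fun x _ => hL _ _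
    _ = j * D := by simp
    _ ≤ _ := Nat.mul_le_mul_right _ hj

lemma exists_a0 {j : ℕ} (f : Fin (j + 1) → Fin (m + 1)) (hf : Function.Injective f) :
    ∃ x₀, ∀ x, x ≠ x₀ → f x ≠ 0 := by
  by_cases h : ∃ x₀, f x₀ = 0
  · obtain ⟨x₀, hx₀⟩ := h
    exact ⟨x₀, fun x hx h => hx (hf (h.trans hx₀.symm))⟩
  · push Not at h
    exact ⟨0, fun x _ => h x⟩

lemma det_upd_sum {k : ℕ} {ι : Type*} {R : Type*} [CommRing R] (F : Matrix (Fin k) (Fin k) R) (x₀ : Fin k)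
    (s : Finset ι) (g : ι → R) (b : ι → Fin k → R) :
    (F.updateRow x₀ (∑ l ∈ s, g l • b l)).det = ∑ l ∈ s, g l * (F.updateRow x₀ (b l)).det := by
  classical
  induction s using Finset.induction_on with
  | empty => exact Matrix.det_eq_zero_of_row_eq_zero x₀ (by simp)
  | insert i s hi ih =>
    rw [Finset.sum_insert hi, Finset.sum_insert hi, Matrix.det_updateRow_add,
      Matrix.det_updateRow_smul, ih]

lemma mn_special (c : Fin (m + 1) → ℝ) (d : Fin (m + 1) → ℕ) (A a : ℝ) {j : ℕ}
    (V : Fin (j + 1) → Fin (m + 1) → ℚ) (f : Fin (j + 1) → Fin (m + 1)) (x₀ : Fin (j + 1))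
    (hx₀ : ∀ x, x ≠ x₀ → f x ≠ 0) :
    mn c d A a V (Function.update f x₀ 0) = C (A * a ^ j) *
      ∑ l, C (c l * ((Matrix.of fun x y => V y (Function.update f x₀ l x)).det : ℚ)) * X ^ d l := by
  classical
  let F : Matrix (Fin (j + 1)) (Fin (j + 1)) ℝ[X] := Matrix.of fun x y => C (V y (f x) : ℝ)
  have h1 : (Matrix.of fun x y => LL c d A a (Function.update f x₀ 0 x) (V y)) =
      Matrix.of fun x y => (if x = x₀ then C A else C a) *
        (F.updateRow x₀ (∑ l, (C (c l) * X ^ d l : ℝ[X]) • fun y => (C (V y l : ℝ) : ℝ[X]))) x y := by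
    ext1 x y
    by_cases hx : x = x₀
    · subst hx
      simp only [Matrix.of_apply, Function.update_self, LL_zero, if_true, Matrix.updateRow_self,
        Finset.sum_apply, Pi.smul_apply, smul_eq_mul]
      congr 1
      refine Finset.sum_congr rfl fun l _ => ?_
      ring
    · simp only [Matrix.of_apply, Function.update_of_ne hx, LL_ne _ _ _ _ (hx₀ x hx), hx, if_false,
        Matrix.updateRow_ne hx, F]
  have h2 : ∀ l, Matrix.det (F.updateRow x₀ fun y => (C (V y l : ℝ) : ℝ[X])) =
      C (((Matrix.of fun x y => V y (Function.update f x₀ l x)).det : ℚ) : ℝ) := by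
    intro l
    have : (C (((Matrix.of fun x y => V y (Function.update f x₀ l x)).det : ℚ) : ℝ) : ℝ[X]) =
      ((C : ℝ →+* ℝ[X]).comp (Rat.castHom ℝ)) (Matrix.of fun x y => V y (Function.update f x₀ l x)).det := rfl
    rw [this, RingHom.map_det]
    congr 1
    ext1 x y
    by_cases hx : x = x₀
    · subst hx; simp
    · simp [Function.update_of_ne hx, Matrix.updateRow_ne hx, F]
  rw [mn, h1, Matrix.det_mul_column]
  congr 1
  · rw [← Finset.mul_prod_erase _ _ (Finset.mem_univ x₀), Finset.prod_congr rfl (g := fun _ => C a)]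
    · simp
    · intro x hx; simp [Finset.ne_of_mem_erase hx]
  · rw [det_upd_sum]
    refine Finset.sum_congr rfl fun l _ => ?_
    rw [h2 l, C_mul]; ring

lemma nrm_sup (c : Fin (m + 1) → ℝ) (d : Fin (m + 1) → ℕ) (hd : Function.Injective d)
    (A a : ℝ) (ha : 0 < a) (ha1 : a ≤ 1) (hA : A * a ^ m = 1) {D : ℕ} (hD : ∀ i, d i ≤ D)
    {K : ℝ} (hK0 : 0 < K) (hK : ∀ P : ℝ[X], P.natDegree ≤ (m + 1) * D → ∀ e,
      ∃ t ∈ Dy 0 1, |P.coeff e| ≤ K * |P.eval t|)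
    {ρ : ℝ} (hρ : ∀ i, ρ * K ≤ |c i|)
    {j : ℕ} (hj : j + 1 ≤ m + 1) (V : Fin (j + 1) → Fin (m + 1) → ℚ) (hV : LinearIndependent ℚ V)
    (hInteg : ∀ y l, ∃ z : ℤ, V y l = z) : ∃ t ∈ Dy 0 1, ρ ≤ nrm c d A a V t := by
  classical
  obtain ⟨f, hf⟩ := exists_minor V hV
  have hinj : Function.Injective f := by
    intro x y hxy
    by_contra hne
    exact hf (Matrix.det_zero_of_row_eq hne (by ext z; simp [hxy]))
  obtain ⟨x₀, hx₀⟩ := exists_a0 f hinj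
  obtain ⟨t, ht, hle⟩ := hK (mn c d A a V (Function.update f x₀ 0)) (mn_deg c d A a hD hj V _) (d (f x₀))
  refine ⟨t, ht, ?_⟩
  have hco : (mn c d A a V (Function.update f x₀ 0)).coeff (d (f x₀)) =
      A * a ^ j * (c (f x₀) * ((Matrix.of fun x y => V y (f x)).det : ℚ)) := by
    rw [mn_special c d A a V f x₀ hx₀, coeff_C_mul, finsetSum_coeff, Finset.sum_eq_single (f x₀)]
    · rw [coeff_C_mul_X_pow, if_pos rfl, Function.update_eq_self]
    · intro l _ hl
      rw [coeff_C_mul_X_pow, if_neg (fun h => hl (hd h).symm)]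
    · simp
  rw [hco, abs_mul (A * a ^ j), abs_mul (c (f x₀))] at hle
  obtain ⟨z, hz⟩ := int_minor hInteg f
  have hz1 : (1 : ℝ) ≤ |(((Matrix.of fun x y => V y (f x)).det : ℚ) : ℝ)| := by
    rw [hz] at hf ⊢
    have : z ≠ 0 := by rintro rfl; simp at hf
    have := Int.one_le_abs this
    rw [Rat.cast_intCast]
    exact_mod_cast this
  have hApos : 0 < A := by
    by_contra h
    have : 0 < a ^ m := by positivity
    nlinarith
  have hA1 : 1 ≤ |A * a ^ j| := by
    rw [abs_of_pos (by positivity), ← hA]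
    gcongr A * ?_
    exact pow_le_pow_of_le_one ha.le ha1 (by omega)
  have h3 : ρ * K ≤ |A * a ^ j| * (|c (f x₀)| * |(((Matrix.of fun x y => V y (f x)).det : ℚ) : ℝ)|) := by
    have h0 := abs_nonneg (c (f x₀))
    calc ρ * K ≤ 1 * (|c (f x₀)| * 1) := by rw [one_mul, mul_one]; exact hρ _
      _ ≤ _ := by gcongr
  have h4 : |(mn c d A a V (Function.update f x₀ 0)).eval t| ≤ nrm c d A a V t :=
    norm_le_pi_norm (fun f => (mn c d A a V f).eval t) _
  have h5 : ρ * K ≤ nrm c d A a V t * K := by nlinarith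
  exact le_of_mul_le_mul_right h5 hK0

end Flow


section Est
open Polynomial
variable {m : ℕ}

lemma nrm_zero (c : Fin (m + 1) → ℝ) (d : Fin (m + 1) → ℕ) (A a : ℝ) {j : ℕ} (hj : j = 0)
    (V : Fin j → Fin (m + 1) → ℚ) (t : ℝ) : nrm c d A a V t ≤ 1 := by
  subst hj
  refine (pi_norm_le_iff_of_nonneg zero_le_one).2 fun f => ?_
  simp [mn]

lemma nrm_sup' (c : Fin (m + 1) → ℝ) (d : Fin (m + 1) → ℕ) (hd : Function.Injective d)
    (A a : ℝ) (ha : 0 < a) (ha1 : a ≤ 1) (hA : A * a ^ m = 1) {D : ℕ} (hD : ∀ i, d i ≤ D)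
    {K : ℝ} (hK0 : 0 < K) (hK : ∀ P : ℝ[X], P.natDegree ≤ (m + 1) * D → ∀ e,
      ∃ t ∈ Dy 0 1, |P.coeff e| ≤ K * |P.eval t|)
    {ρ : ℝ} (hρ : ∀ i, ρ * K ≤ |c i|)
    {j : ℕ} (hj0 : j ≠ 0) (hj : j ≤ m + 1) (V : Fin j → Fin (m + 1) → ℚ) (hV : LinearIndependent ℚ V)
    (hInteg : ∀ y l, ∃ z : ℤ, V y l = z) : ∃ t ∈ Dy 0 1, ρ ≤ nrm c d A a V t := by
  obtain ⟨i, rfl⟩ := Nat.exists_eq_succ_of_ne_zero hj0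
  exact nrm_sup c d hd A a ha ha1 hA hD hK0 hK hρ hj V hV hInteg

lemma prot_no_short (c : Fin (m + 1) → ℝ) (d : Fin (m + 1) → ℕ) (A a : ℝ) {ε ρ η : ℝ}
    (hε : 0 < ε) (hερ : ε ≤ ρ) (hρ1 : ρ ≤ 1) (hη : (m + 1) * η < ε) (z : ℝ)
    (hz : Prot (fun (W : Submodule ℚ (Fin (m + 1) → ℚ)) t => nrm c d A a (VW W) t) ε ρ
      {W | W ≠ ⊥} z) (v : Fin (m + 1) → ℚ) (hv : v ≠ 0) (hvint : ∀ l, ∃ y : ℤ, v l = y) :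
    ¬ ∀ i, |(LL c d A a i v).eval z| ≤ η := by
  classical
  intro hle
  obtain ⟨S, hST, hchain, hm1, hm2⟩ := hz
  have hη0 : 0 ≤ η := (abs_nonneg _).trans (hle 0)
  have hW0 : ∃ W₀ : Submodule ℚ (Fin (m + 1) → ℚ), (W₀ = ⊥ ∨ W₀ ∈ S) ∧ v ∉ W₀ ∧
      ∀ U ∈ S, v ∉ U → U ≤ W₀ := by
    rcases (S.filter (fun U => v ∉ U)).eq_empty_or_nonempty with h | h
    · refine ⟨⊥, Or.inl rfl, by simpa using hv, fun U hU hvU => ?_⟩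
      have : U ∈ S.filter (fun U => v ∉ U) := Finset.mem_filter.2 ⟨hU, hvU⟩
      rw [h] at this; simp at this
    · obtain ⟨W₀, hW₀, hmax⟩ := Finset.exists_max_image _ (fun U : Submodule ℚ (Fin (m + 1) → ℚ) => Module.finrank ℚ U) h
      rw [Finset.mem_filter] at hW₀
      refine ⟨W₀, Or.inr hW₀.1, hW₀.2, fun U hU hvU => ?_⟩
      rcases hchain.total hU hW₀.1 with h1 | h1
      · exact h1
      · have := hmax U (Finset.mem_filter.2 ⟨hU, hvU⟩)
        exact (Submodule.eq_of_le_of_finrank_le h1 this).ge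
  obtain ⟨W₀, hW₀, hvW₀, hbelow⟩ := hW0
  let W₁ := W₀ ⊔ Submodule.span ℚ {v}
  have hvW₁ : v ∈ W₁ := (le_sup_right : _ ≤ W₁) (Submodule.mem_span_singleton_self v)
  have hW₁ne : W₁ ≠ ⊥ := by
    intro h
    rw [h] at hvW₁
    exact hv (by simpa using hvW₁)
  have hcomp : ∀ U ∈ S, W₁ ≤ U ∨ U ≤ W₁ := by
    intro U hU
    by_cases hvU : v ∈ U
    · left
      refine sup_le ?_ ((Submodule.span_singleton_le_iff_mem _ _).2 hvU)
      rcases hW₀ with rfl | hW₀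
      · exact bot_le
      · rcases hchain.total hW₀ hU with h1 | h1
        · exact h1
        · exact absurd (h1 hvU) hvW₀
    · right
      exact (hbelow U hU hvU).trans le_sup_left
  have hlow : ε ≤ nrm c d A a (VW W₁) z := by
    by_cases hS : W₁ ∈ S
    · exact (hm1 W₁ hS).1
    · exact hερ.trans (hm2 W₁ hW₁ne hS hcomp)
  have hspan : Submodule.span ℚ (Set.range (VW W₀)) ≤ W₀ := by
    rw [Submodule.span_le]; rintro _ ⟨y, rfl⟩; exact (VW_int W₀).mem y
  have hli : LinearIndependent ℚ (Fin.cons v (VW W₀) : Fin (Module.finrank ℚ W₀ + 1) → Fin (m + 1) → ℚ) :=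
    linearIndependent_finCons.2 ⟨(VW_int W₀).li, fun h => hvW₀ (hspan h)⟩
  have hmem : ∀ y, (Fin.cons v (VW W₀) : Fin (Module.finrank ℚ W₀ + 1) → Fin (m + 1) → ℚ) y ∈ W₁ := by
    intro y
    refine Fin.cases ?_ (fun y => ?_) y
    · exact hvW₁
    · exact (le_sup_left : W₀ ≤ W₁) ((VW_int W₀).mem y)
  have hfam : IntFam W₁ (Fin.cons v (VW W₀) : Fin (Module.finrank ℚ W₀ + 1) → Fin (m + 1) → ℚ) := by
    refine ⟨hli, hmem, ?_, ?_⟩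
    · intro y
      refine Fin.cases ?_ (fun y => ?_) y
      · exact hvint
      · exact (VW_int W₀).int y
    · apply le_antisymm
      · refine (Submodule.finrank_add_le_finrank_add_finrank _ _).trans ?_
        rw [finrank_span_singleton hv]
      · have h1 := finrank_span_eq_card hli
        rw [Fintype.card_fin] at h1
        rw [← h1]
        apply Submodule.finrank_mono
        rw [Submodule.span_le]; rintro _ ⟨y, rfl⟩; exact hmem y
  have hrank : Module.finrank ℚ W₀ + 1 ≤ m + 1 := by
    rw [← hfam.rank]
    exact (Submodule.finrank_le W₁).trans (by simp)
  have h1 := nrm_compare c d A a W₁ _ hfam z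
  have h2 := nrm_cons c d A a (VW W₀) v z η hle
  have h3 : nrm c d A a (VW W₀) z ≤ 1 := by
    rcases hW₀ with h | h
    · exact nrm_zero c d A a (by rw [h]; simp) _ _
    · exact (hm1 W₀ h).2.le.trans hρ1
  have h4 : ((Module.finrank ℚ W₀ : ℝ) + 1) ≤ m + 1 := by exact_mod_cast hrank
  have h5 : ((Module.finrank ℚ W₀ : ℝ) + 1) * (η * nrm c d A a (VW W₀) z) ≤ (m + 1) * (η * 1) := by
    have : 0 ≤ nrm c d A a (VW W₀) z := norm_nonneg _
    gcongr
  linarith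

theorem flow_est (c : Fin (m + 1) → ℝ) (hc : ∀ i, c i ≠ 0) (d : Fin (m + 1) → ℕ)
    (hd : Function.Injective d) :
    ∃ K ρ α : ℝ, 0 < K ∧ 0 < ρ ∧ 0 < α ∧ ∀ A a : ℝ, 0 < a → a ≤ 1 → A * a ^ m = 1 →
      ∀ ε η : ℝ, 0 < ε → ε ≤ ρ → (m + 1) * η < ε →
        volume (Dy 0 1 ∩ {t | ∃ v : Fin (m + 1) → ℤ, v ≠ 0 ∧
          ∀ i, |(LL c d A a i (fun l => (v l : ℚ))).eval t| ≤ η}) ≤ ENNReal.ofReal (K * ε ^ α) := by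
  classical
  obtain ⟨i₀, -, hi₀⟩ := Finset.exists_min_image (Finset.univ : Finset (Fin (m + 1)))
    (fun i => |c i|) ⟨0, Finset.mem_univ _⟩
  let D := Finset.univ.sup d
  have hD : ∀ i, d i ≤ D := fun i => Finset.le_sup (Finset.mem_univ i)
  obtain ⟨K₀, hK₀, hK⟩ := coeff_bound ((m + 1) * D)
  have hci : 0 < |c i₀| := abs_pos.2 (hc i₀)
  let ρ : ℝ := min 1 (|c i₀| / K₀)
  have hρ : 0 < ρ := lt_min one_pos (by positivity)
  have hρ1 : ρ ≤ 1 := min_le_left _ _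
  have hρc : ∀ i, ρ * K₀ ≤ |c i| := by
    intro i
    have h1 : ρ ≤ |c i₀| / K₀ := min_le_right _ _
    rw [le_div_iff₀ hK₀] at h1
    exact h1.trans (hi₀ i (Finset.mem_univ i))
  let E : ℕ := (m + 1) * D + 1
  have hE : (0 : ℝ) < E := by simp only [E]; positivity
  let K : ℝ := (KK (m + 1)).toReal * (2 * E * ((E + 1) / ρ) ^ (1 / (E : ℝ))) + 1
  refine ⟨K, ρ, 1 / E, by positivity, hρ, by positivity, ?_⟩
  intro A a ha ha1 hA ε η hε hερ hη
  let ψ : Submodule ℚ (Fin (m + 1) → ℚ) → ℝ → ℝ := fun W t => nrm c d A a (VW W) t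
  have hfr : ∀ W : Submodule ℚ (Fin (m + 1) → ℚ), Module.finrank ℚ W ≤ m + 1 := fun W =>
    (Submodule.finrank_le W).trans (by simp)
  have hnd := nondiv ψ (fun W => nrm_cont c d A a (VW W)) ε ρ
    (ENNReal.ofReal (2 * E * (((E + 1) * ε / ρ) ^ (1 / (E : ℝ)))))
    (fun W n b hex => fam_good E (by simp [E]) (mn c d A a (VW W))
      (fun f => (mn_deg c d A a hD (hfr W) _ f).trans (by simp [E])) hε hρ n b hex)
    (m + 1) {W | W ≠ ⊥} (by
      intro S hS hch
      have : S.card ≤ (Finset.Icc 1 (m + 1)).card := by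
        apply Finset.card_le_card_of_injOn (fun W : Submodule ℚ (Fin (m + 1) → ℚ) => Module.finrank ℚ W)
        · intro W hW
          have h1 : W ≠ ⊥ := hS hW
          have : Module.finrank ℚ W ≠ 0 := fun h => h1 (Submodule.finrank_eq_zero.1 h)
          simp only [Finset.coe_Icc, Set.mem_Icc]
          exact ⟨by omega, hfr W⟩
        · intro U hU W hW h
          rcases hch.total hU hW with h1 | h1
          · exact Submodule.eq_of_le_of_finrank_eq h1 h
          · exact (Submodule.eq_of_le_of_finrank_eq h1 h.symm).symm
      simpa using this) 0 1 (by
      intro W hW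
      exact nrm_sup' c d hd A a ha ha1 hA hD hK₀ hK hρc
        (fun h => hW (Submodule.finrank_eq_zero.1 h)) (hfr W) (VW W) (VW_int W).li (VW_int W).int)
  have hsub : Dy 0 1 ∩ {t | ∃ v : Fin (m + 1) → ℤ, v ≠ 0 ∧
          ∀ i, |(LL c d A a i (fun l => (v l : ℚ))).eval t| ≤ η} ⊆
        Dy 0 1 ∩ {z | ¬ Prot ψ ε ρ {W | W ≠ ⊥} z} := by
    rintro t ⟨ht, v, hv, hvle⟩
    refine ⟨ht, fun hP => ?_⟩
    refine prot_no_short c d A a hε hερ hρ1 hη t hP (fun l => (v l : ℚ)) ?_ (fun l => ⟨v l, rfl⟩) hvle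
    intro h
    exact hv (funext fun l => by simpa using congrFun h l)
  refine (measure_mono hsub).trans (hnd.trans ?_)
  rw [vol_Dy]
  simp only [pow_zero, div_one, ENNReal.ofReal_one, mul_one]
  rw [← ENNReal.ofReal_toReal (KK_ne_top (m + 1)), ← ENNReal.ofReal_mul ENNReal.toReal_nonneg]
  apply ENNReal.ofReal_le_ofReal
  have hsplit : ((E + 1) * ε / ρ) ^ (1 / (E : ℝ)) = ((E + 1) / ρ) ^ (1 / (E : ℝ)) * ε ^ (1 / (E : ℝ)) := by
    rw [← Real.mul_rpow (by positivity) hε.le]; congr 1; ring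
  rw [hsplit]
  have : 0 ≤ ε ^ (1 / (E : ℝ)) := by positivity
  simp only [K]
  nlinarith

end Est


section OneDim
open Polynomial Filter
variable {m : ℕ}

theorem one_dim (c : Fin (m + 1) → ℝ) (hc : ∀ i, c i ≠ 0) (d : Fin (m + 1) → ℕ)
    (hd : Function.Injective d) (e : ℝ) (he : 0 < e) :
    ∀ᵐ t : ℝ, t ∈ Dy 0 1 → ∃ κ : ℝ, 0 < κ ∧ ∀ v : Fin (m + 1) → ℤ,
      (fun i : Fin m => v i.succ) ≠ 0 →
        κ / ((Finset.univ.sup fun i : Fin m => (v i.succ).natAbs : ℕ) : ℝ) ^ ((m : ℝ) + e) <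
          |∑ l, (v l : ℝ) * (c l * t ^ d l)| := by
  obtain ⟨K, ρ, α, hK, hρ, hα, hest⟩ := flow_est c hc d hd
  let θ : ℝ := (2 : ℝ) ^ (-e / (m + 1))
  have hθ : 0 < θ := by positivity
  have hθ1 : θ < 1 := by
    apply Real.rpow_lt_one_of_one_lt_of_neg (by norm_num)
    rw [neg_div]
    have : 0 < e / (m + 1) := by positivity
    linarith
  let β : ℝ := (2 : ℝ) ^ (-((m : ℝ) + e))
  have hβ : 0 < β := by positivity
  have hβθ : β = (1 / 2) ^ m * θ ^ (m + 1) := by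
    have h1 : θ ^ (m + 1) = (2 : ℝ) ^ (-e) := by
      rw [← Real.rpow_natCast, ← Real.rpow_mul (by norm_num)]
      congr 1; push_cast; field_simp
    rw [h1]
    simp only [β]
    rw [neg_add, Real.rpow_add (by norm_num), Real.rpow_neg (by norm_num), Real.rpow_natCast]
    simp
  -- beginning of the range of scales
  have htend : Tendsto (fun k : ℕ => ((m : ℝ) + 2) * θ ^ k) atTop (nhds 0) := by
    simpa using (tendsto_pow_atTop_nhds_zero_of_lt_one hθ.le hθ1).const_mul ((m : ℝ) + 2)
  obtain ⟨k₀, hk₀⟩ := eventually_atTop.1 (htend.eventually (gt_mem_nhds hρ))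
  let a : ℕ → ℝ := fun k => (θ / 2) ^ k
  let A : ℕ → ℝ := fun k => ((a k) ^ m)⁻¹
  have ha : ∀ k, 0 < a k := fun k => by positivity
  let Bad : ℕ → Set ℝ := fun k => Dy 0 1 ∩ {t | ∃ v : Fin (m + 1) → ℤ, v ≠ 0 ∧
          ∀ i, |(LL c d (A k) (a k) i (fun l => (v l : ℚ))).eval t| ≤ θ ^ k}
  have hBad : ∀ k, volume (Bad (k + k₀)) ≤
      ENNReal.ofReal (K * (((m : ℝ) + 2) ^ α * (θ ^ k₀) ^ α) * (θ ^ α) ^ k) := by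
    intro k
    have h := hest (A (k + k₀)) (a (k + k₀)) (ha _)
      (pow_le_one₀ (by positivity) (by linarith)) (inv_mul_cancel₀ (pow_pos (ha _) m).ne')
      (((m : ℝ) + 2) * θ ^ (k + k₀)) (θ ^ (k + k₀)) (by positivity) (hk₀ _ (by omega)).le
      (by have : 0 < θ ^ (k + k₀) := by positivity
          nlinarith)
    refine h.trans (le_of_eq ?_)
    congr 1
    rw [Real.mul_rpow (by positivity) (by positivity), pow_add, Real.mul_rpow (by positivity) (by positivity),
      ← Real.rpow_natCast (θ ^ α), ← Real.rpow_mul hθ.le, mul_comm α, Real.rpow_mul hθ.le, Real.rpow_natCast]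
    ring
  have hsum : ∑' k, volume (Bad (k + k₀)) ≠ ⊤ := by
    have hs : Summable (fun k : ℕ => K * (((m : ℝ) + 2) ^ α * (θ ^ k₀) ^ α) * (θ ^ α) ^ k) :=
      (summable_geometric_of_lt_one (by positivity) (Real.rpow_lt_one hθ.le hθ1 hα)).mul_left _
    refine ne_top_of_le_ne_top ?_ (ENNReal.tsum_le_tsum hBad)
    rw [← ENNReal.ofReal_tsum_of_nonneg (fun k => by positivity) hs]
    exact ENNReal.ofReal_ne_top
  filter_upwards [ae_eventually_notMem hsum] with t ht htD
  obtain ⟨k₁, hk₁⟩ := eventually_atTop.1 ht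
  refine ⟨β ^ (k₁ + k₀ + 1), by positivity, fun v hv => ?_⟩
  set N := Finset.univ.sup fun i : Fin m => (v i.succ).natAbs with hN
  have hle : ∀ i : Fin m, (v i.succ).natAbs ≤ N := fun i =>
    Finset.le_sup (f := fun i : Fin m => (v i.succ).natAbs) (Finset.mem_univ i)
  have hN0 : N ≠ 0 := by
    intro h
    apply hv
    funext i
    have := hle i
    simp only [Pi.zero_apply]; omega
  have hv0 : v ≠ 0 := by rintro rfl; exact hv (by funext i; simp)
  have hnot := hk₁ (k₁ + (Nat.log 2 N + 1)) (by omega)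
  set k := k₁ + (Nat.log 2 N + 1) + k₀ with hk
  have hF : β ^ k < |∑ l, (v l : ℝ) * (c l * t ^ d l)| := by
    by_contra hcon
    push Not at hcon
    refine hnot ⟨htD, v, hv0, fun i => ?_⟩
    by_cases hi : i = 0
    · subst hi
      rw [LL_zero, eval_mul, eval_C, eval_finsetSum, abs_mul]
      simp only [eval_mul, eval_C, eval_pow, eval_X, Rat.cast_intCast]
      have hApos : 0 < A k := by have := ha k; positivity
      rw [abs_of_pos hApos]
      calc A k * _ ≤ A k * β ^ k := by gcongr
        _ = θ ^ k := by
          have h1 : β ^ k = (a k) ^ m * θ ^ k := by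
            simp only [a]
            rw [hβθ, ← pow_mul, mul_comm k m, pow_mul, ← mul_pow]
            congr 1
            rw [pow_succ, div_pow, div_pow]; ring
          rw [h1]
          exact inv_mul_cancel_left₀ (pow_pos (ha k) m).ne' _
    · rw [LL_ne _ _ _ _ hi]
      simp only [eval_mul, eval_C, Rat.cast_intCast, abs_mul]
      rw [abs_of_pos (ha k)]
      obtain ⟨i', rfl⟩ := Fin.exists_succ_eq.2 hi
      have h1 : |(v i'.succ : ℝ)| ≤ 2 ^ k := by
        have h2 : (v i'.succ).natAbs ≤ 2 ^ k := by
          refine (hle i').trans ((Nat.lt_pow_succ_log_self (b := 2) (by norm_num) N).le.trans ?_)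
          exact Nat.pow_le_pow_right (by norm_num) (by omega)
        rw [← Int.cast_abs, Int.abs_eq_natAbs]
        exact_mod_cast h2
      calc a k * _ ≤ a k * 2 ^ k := by have := ha k; gcongr
        _ = θ ^ k := by simp only [a]; rw [← mul_pow]; congr 1; ring
  refine lt_of_le_of_lt ?_ hF
  have hNpos : (0 : ℝ) < N := by exact_mod_cast Nat.pos_of_ne_zero hN0
  have hkey : 1 / (N : ℝ) ^ ((m : ℝ) + e) ≤ β ^ (Nat.log 2 N) := by
    have h1 : β ^ (Nat.log 2 N) = 1 / ((2 : ℝ) ^ (Nat.log 2 N)) ^ ((m : ℝ) + e) := by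
      simp only [β]
      rw [Real.rpow_neg (by norm_num), inv_pow, one_div, ← Real.rpow_natCast, ← Real.rpow_mul (by norm_num),
        mul_comm, Real.rpow_mul (by norm_num), Real.rpow_natCast]
    rw [h1]
    have h2 : (2 : ℝ) ^ (Nat.log 2 N) ≤ N := by exact_mod_cast Nat.pow_log_le_self 2 hN0
    gcongr
  calc β ^ (k₁ + k₀ + 1) / (N : ℝ) ^ ((m : ℝ) + e)
      = β ^ (k₁ + k₀ + 1) * (1 / (N : ℝ) ^ ((m : ℝ) + e)) := by ring
    _ ≤ β ^ (k₁ + k₀ + 1) * β ^ (Nat.log 2 N) := by gcongr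
    _ = β ^ k := by rw [← pow_add]; congr 1; omega

end OneDim


section Final

lemma digit_inj {n B : ℕ} (hB : 1 < B) (u v : Fin n → ℕ) (hu : ∀ j, u j < B) (hv : ∀ j, v j < B)
    (h : ∑ j : Fin n, B ^ (j : ℕ) * u j = ∑ j : Fin n, B ^ (j : ℕ) * v j) : u = v := by
  refine List.ofFn_inj.mp ?_
  apply Nat.ofDigits_inj_of_len_eq hB (by simp)
  · intro l hl
    obtain ⟨j, rfl⟩ := (List.mem_ofFn' _ _).1 hl
    exact hu j
  · intro l hl
    obtain ⟨j, rfl⟩ := (List.mem_ofFn' _ _).1 hl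
    exact hv j
  have key : ∀ f : Fin n → ℕ, Nat.ofDigits B (List.ofFn f) = ∑ j : Fin n, B ^ (j : ℕ) * f j := by
    clear h hu hv u v
    induction n with
    | zero => intro f; simp
    | succ n ih =>
      intro f
      rw [List.ofFn_succ, Nat.ofDigits_cons, ih, Fin.sum_univ_succ, Finset.mul_sum]
      simp [pow_succ']
      simp only [mul_assoc]
  rw [key, key, h]

lemma exists_weights {n m : ℕ} (s : Fin m → Fin n → ℕ) (hdist : Function.Injective s)
    (hne : ∀ i : Fin m, s i ≠ 0) : ∃ w : Fin n → ℕ,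
      Function.Injective (Fin.cons 0 (fun i => ∑ j, w j * s i j) : Fin (m + 1) → ℕ) := by
  let B : ℕ := (∑ i, ∑ j, s i j) + 2
  have hlt : ∀ i j, s i j < B := by
    intro i j
    have h1 : s i j ≤ ∑ j, s i j := Finset.single_le_sum (f := fun j => s i j) (fun _ _ => Nat.zero_le _) (Finset.mem_univ j)
    have h2 : ∑ j, s i j ≤ ∑ i, ∑ j, s i j :=
      Finset.single_le_sum (f := fun i => ∑ j, s i j) (fun _ _ => Nat.zero_le _) (Finset.mem_univ i)
    simp only [B]; omega
  have hB : 1 < B := by simp only [B]; omega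
  refine ⟨fun j => B ^ (j : ℕ), ?_⟩
  rw [Fin.cons_injective_iff]
  constructor
  · rintro ⟨i, hi⟩
    apply hne i
    apply digit_inj hB (s i) 0 (hlt i) (fun j => by simp only [Pi.zero_apply]; omega)
    simpa using hi
  · intro i i' h
    exact hdist (digit_inj hB _ _ (hlt i) (hlt i') h)

/-- The quantitative non-approximability property, in a countable form. -/
def Good {n m : ℕ} (s : Fin m → Fin n → ℕ) (e : ℝ) (x : Fin n → ℝ) : Prop :=
  ∃ k : ℕ, ∀ (p : ℤ) (q : Fin m → ℤ), q ≠ 0 →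
    (1 / ((k : ℝ) + 1)) / ((Finset.univ.sup fun i : Fin m => (q i).natAbs : ℕ) : ℝ) ^ ((m : ℝ) + e) <
      |(p : ℝ) + ∑ i : Fin m, (q i : ℝ) * ∏ j : Fin n, x j ^ s i j|

lemma meas_Good {n m : ℕ} (s : Fin m → Fin n → ℕ) (e : ℝ) : MeasurableSet {x | Good s e x} := by
  have : {x | Good s e x} = ⋃ k : ℕ, ⋂ (p : ℤ), ⋂ (q : Fin m → ℤ), ⋂ (_ : q ≠ 0),
    {x : Fin n → ℝ | (1 / ((k : ℝ) + 1)) / ((Finset.univ.sup fun i : Fin m => (q i).natAbs : ℕ) : ℝ) ^ ((m : ℝ) + e) <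
      |(p : ℝ) + ∑ i : Fin m, (q i : ℝ) * ∏ j : Fin n, x j ^ s i j|} := by
    ext x
    simp [Good]
  rw [this]
  refine MeasurableSet.iUnion fun k => MeasurableSet.iInter fun p => MeasurableSet.iInter fun q =>
    MeasurableSet.iInter fun _ => ?_
  apply measurableSet_lt
  · exact measurable_const
  · apply Measurable.abs
    fun_prop

lemma good_line {n m : ℕ} (s : Fin m → Fin n → ℕ) (w : Fin n → ℕ)
    (hw : Function.Injective (Fin.cons 0 (fun i => ∑ j, w j * s i j) : Fin (m + 1) → ℕ))
    (e : ℝ) (he : 0 < e) (y : Fin n → ℝ) (hy : ∀ j, y j ≠ 0) :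
    ∀ᵐ t : ℝ, t ∈ Dy 0 1 → Good s e (fun j => y j * t ^ w j) := by
  have h := one_dim (Fin.cons 1 (fun i => ∏ j, y j ^ s i j) : Fin (m + 1) → ℝ)
    (by
      intro i
      refine Fin.cases ?_ (fun i => ?_) i
      · simp
      · simp only [Fin.cons_succ]
        exact Finset.prod_ne_zero_iff.2 fun j _ => pow_ne_zero _ (hy j))
    _ hw e he
  filter_upwards [h] with t ht htD
  obtain ⟨κ, hκ, hh⟩ := ht htD
  obtain ⟨k, hk⟩ := exists_nat_one_div_lt hκ
  refine ⟨k, fun p q hq => ?_⟩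
  have h1 := hh (Fin.cons p q) (by simpa using hq)
  simp only [Fin.cons_succ, Fin.sum_univ_succ, Fin.cons_zero, pow_zero, mul_one] at h1
  have h2 : ∀ i, ∏ j, (y j * t ^ w j) ^ s i j = (∏ j, y j ^ s i j) * t ^ (∑ j, w j * s i j) := by
    intro i
    rw [← Finset.prod_pow_eq_pow_sum, ← Finset.prod_mul_distrib]
    refine Finset.prod_congr rfl fun j _ => ?_
    rw [mul_pow, pow_mul]
  simp only [h2]
  refine lt_of_le_of_lt ?_ h1
  gcongr

lemma ae_good {n m : ℕ} (s : Fin m → Fin n → ℕ) (hdist : Function.Injective s)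
    (hne : ∀ i : Fin m, s i ≠ 0) (e : ℝ) (he : 0 < e) :
    ∀ᵐ x : Fin n → ℝ, Good s e x := by
  obtain ⟨w, hw⟩ := exists_weights s hdist hne
  have h1 : ∀ᵐ y : Fin n → ℝ, ∀ᵐ t : ℝ, t ∈ Dy 0 1 → Good s e (fun j => y j * t ^ w j) := by
    have h0 : ∀ᵐ y : Fin n → ℝ, ∀ j, y j ≠ 0 :=
      ae_all_iff.2 fun j => Measure.ae_eval_ne _ j 0
    filter_upwards [h0] with y hy
    exact good_line s w hw e he y hy
  rw [Measure.ae_ae_comm] at h1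
  · have h2 := ae_restrict_of_ae (s := Dy 0 1) h1
    obtain ⟨t, htD, ht⟩ := Measure.exists_mem_of_measure_ne_zero_of_ae
      (by rw [vol_Dy]; simp) h2
    have ht1 : 1 ≤ t := by
      have := htD
      rw [Dy_eq] at this
      simpa using this.1
    have ht0 : t ≠ 0 := by linarith
    let D : Fin n → ℝ := fun j => (t ^ w j)⁻¹
    have hdet : (Matrix.diagonal D).det ≠ 0 := by
      rw [Matrix.det_diagonal]
      exact Finset.prod_ne_zero_iff.2 fun j _ => inv_ne_zero (pow_ne_zero _ ht0)
    have hmap := Real.map_matrix_volume_pi_eq_smul_volume_pi hdet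
    have h3 : ∀ᵐ y : Fin n → ℝ, Good s e (fun j => y j * t ^ w j) := by
      filter_upwards [ht] with y hy using hy htD
    have h4 := Measure.ae_smul_measure h3 (ENNReal.ofReal |((Matrix.diagonal D).det)⁻¹|)
    rw [← hmap] at h4
    have h5 := ae_of_ae_map (LinearMap.continuous_of_finiteDimensional _).aemeasurable h4
    filter_upwards [h5] with x hx
    convert hx using 2 with j
    simp only [Matrix.toLin'_apply, Matrix.mulVec_diagonal, D]
    field_simp
  · have hm : Measurable (fun z : (Fin n → ℝ) × ℝ => (fun j => z.1 j * z.2 ^ w j : Fin n → ℝ)) := by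
      fun_prop
    have e1 : {x : (Fin n → ℝ) × ℝ | x.2 ∈ Dy 0 1 → Good s e (fun j => x.1 j * x.2 ^ w j)} =
      (Prod.snd ⁻¹' (Dy 0 1))ᶜ ∪ (fun z : (Fin n → ℝ) × ℝ => (fun j => z.1 j * z.2 ^ w j : Fin n → ℝ)) ⁻¹' {x | Good s e x} := by
      ext z
      simp [imp_iff_not_or]
    rw [e1]
    exact (measurable_snd (meas_Dy 0 1)).compl.union (hm (meas_Good s e))

end Final

theorem stmt_11 (n m : ℕ) (hn : 1 ≤ n) (hm : 1 ≤ m)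
    (s : Fin m → Fin n → ℕ)
    (hdist : Function.Injective s)
    (hne : ∀ i : Fin m, s i ≠ 0)
    (ε : ℝ) (hε : 0 < ε) :
    ∀ᵐ x ∂(volume : Measure (Fin n → ℝ)),
      ∃ κ : ℝ, 0 < κ ∧
        ∀ (p : ℤ) (q : Fin m → ℤ), q ≠ 0 →
          |(p : ℝ) + ∑ i : Fin m, (q i : ℝ) * ∏ j : Fin n, x j ^ s i j| >
            κ / ((Finset.univ.sup fun i : Fin m => (q i).natAbs : ℕ) : ℝ) ^ ((m : ℝ) + ε) := by
  filter_upwards [ae_good s hdist hne ε hε] with x hx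
  obtain ⟨k, hk⟩ := hx
  exact ⟨1 / ((k : ℝ) + 1), by positivity, fun p q hq => hk p q hq⟩
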